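/- There exists an ideal I ⊂ K[X][U] together with an I-specific elimination order ≺ for U such that the Gröbner cone C_≺(I) intersects the boundary of the orthant Ω = ℝ_{≥0}^{n+m} only in the origin. Concretely, for n = m = 1 and I = ⟨x² − 1, xu² − x − u⟩ ⊆ ℚ[x,u], there is an I-specific elimination order ≺ for u with C_≺(I) ∩ ∂(ℝ_{≥0}²) = {0}. -/

import Mathlib

open MvPolynomial

/-- A monomial order on exponent vectors in `Fin N →₀ ℕ`:
a linear order compatible with addition in which `0` is the least element. -/
structure MonoOrder (N : ℕ) where
  lt : (Fin N →₀ ℕ) → (Fin N →₀ ℕ) → Prop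
  total : ∀ a b, a = b ∨ lt a b ∨ lt b a
  trans : ∀ a b c, lt a b → lt b c → lt a c
  irrefl : ∀ a, ¬ lt a a
  add_right : ∀ a b c, lt a b → lt (a + c) (b + c)
  zero_lt : ∀ a, a ≠ 0 → lt 0 a

variable {N : ℕ} {K : Type*} [Field K]

/-- The ω-degree `ω · d` of an exponent vector `d`. -/
noncomputable def wdeg (ω : Fin N → ℝ) (d : Fin N → ℕ) : ℝ :=
  ∑ i, ω i * (d i : ℝ)

/-- The ≺-maximal exponent in the support of `p` (the exponent of the leading term). -/
noncomputable def leadExp (mo : MonoOrder N) (p : MvPolynomial (Fin N) K) : Fin N →₀ ℕ :=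
  open Classical in
  if h : ∃ d ∈ p.support, ∀ e ∈ p.support, e ≠ d → mo.lt e d then h.choose else 0

/-- The leading term `lt_≺(p)` of `p` w.r.t. the monomial order `mo`. -/
noncomputable def leadTerm (mo : MonoOrder N) (p : MvPolynomial (Fin N) K) :
    MvPolynomial (Fin N) K :=
  monomial (leadExp mo p) (p.coeff (leadExp mo p))

/-- `p ∈ K[X]`: the polynomial `p` involves only the first `n` variables. -/
def inKX (n : ℕ) (p : MvPolynomial (Fin N) K) : Prop :=
  ∀ d ∈ p.support, ∀ i : Fin N, n ≤ (i : ℕ) → d i = 0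

open Classical in
/-- Initial form `lt_ω(p)`: the sum of the terms of `p` of maximal ω-degree. -/
noncomputable def initForm (ω : Fin N → ℝ) (p : MvPolynomial (Fin N) K) :
    MvPolynomial (Fin N) K :=
  ∑ d ∈ p.support.filter (fun d : Fin N →₀ ℕ => ∀ e ∈ p.support, wdeg ω ⇑e ≤ wdeg ω ⇑d),
    monomial d (p.coeff d)

/-- The initial ideal `⟨lt_ω(I)⟩` w.r.t. a weight vector ω. -/
noncomputable def ltIdealW (ω : Fin N → ℝ) (I : Ideal (MvPolynomial (Fin N) K)) :
    Ideal (MvPolynomial (Fin N) K) :=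
  Ideal.span (initForm ω '' (I : Set (MvPolynomial (Fin N) K)))

/-- The initial ideal `⟨lt_≺(I)⟩` w.r.t. a monomial order. -/
noncomputable def ltIdealO (mo : MonoOrder N) (I : Ideal (MvPolynomial (Fin N) K)) :
    Ideal (MvPolynomial (Fin N) K) :=
  Ideal.span (leadTerm mo '' (I : Set (MvPolynomial (Fin N) K)))

/-- The Gröbner cone `C_≺(I)`. -/
noncomputable def gCone (mo : MonoOrder N) (I : Ideal (MvPolynomial (Fin N) K)) :
    Set (Fin N → ℝ) :=
  closure {ω | (∀ i, 0 ≤ ω i) ∧ ltIdealW ω I = ltIdealO mo I}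

/-- `G` is the normed reduced Gröbner basis of `I` w.r.t. `mo`. -/
def IsRedGB (mo : MonoOrder N) (I : Ideal (MvPolynomial (Fin N) K))
    (G : Set (MvPolynomial (Fin N) K)) : Prop :=
  G.Finite ∧ G ⊆ (I : Set (MvPolynomial (Fin N) K)) ∧
  Ideal.span (leadTerm mo '' G) = ltIdealO mo I ∧
  (∀ g ∈ G, g ≠ 0 ∧ g.coeff (leadExp mo g) = 1) ∧
  (∀ g ∈ G, ∀ h ∈ G, g ≠ h → ∀ d ∈ h.support, ¬ leadExp mo g ≤ d)

/-- `mo` is an `I`-specific elimination order for the last variables: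
every element of the reduced Gröbner basis whose leading term lies in `K[X]`
lies itself in `K[X]`. -/
def IsEO (n : ℕ) (mo : MonoOrder N) (I : Ideal (MvPolynomial (Fin N) K)) : Prop :=
  ∀ G : Set (MvPolynomial (Fin N) K), IsRedGB mo I G →
    ∀ g ∈ G, inKX n (leadTerm mo g) → inKX n g

/-- `ω` is an `I`-specific elimination vector. -/
def IsEV (n : ℕ) (I : Ideal (MvPolynomial (Fin N) K)) (ω : Fin N → ℝ) : Prop :=
  (∀ i, 0 ≤ ω i) ∧ ∃ mo : MonoOrder N, IsEO n mo I ∧ ω ∈ gCone mo I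

/-- The monomial order `mo` refines the weight vector `ω`. -/
def Refines (mo : MonoOrder N) (ω : Fin N → ℝ) : Prop :=
  ∀ d e : Fin N →₀ ℕ, wdeg ω ⇑d < wdeg ω ⇑e → mo.lt d e

/-- `Ω_u`: the set of weight vectors vanishing on the first `n` coordinates. -/
def OmegaU (n N : ℕ) : Set (Fin N → ℝ) :=
  {ω | (∀ i, 0 ≤ ω i) ∧ ∀ i : Fin N, (i : ℕ) < n → ω i = 0}

/-- `L_{X,≺}(G)`: the elements of `G` whose leading term lies in `K[X]`. -/
def LXset (n : ℕ) (mo : MonoOrder N) (G : Set (MvPolynomial (Fin N) K)) :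
    Set (MvPolynomial (Fin N) K) :=
  {p ∈ G | inKX n (leadTerm mo p)}
lemma castAdd_inj (n m : ℕ) : Function.Injective (Fin.castAdd m : Fin n → Fin (n + m)) := by
  intro a b h
  exact Fin.ext (by simpa using congrArg Fin.val h)

/-- Extend an exponent vector on the first `n` variables to all `n + m` variables. -/
noncomputable def extExp (n m : ℕ) (a : Fin n →₀ ℕ) : Fin (n + m) →₀ ℕ :=
  Finsupp.mapDomain (Fin.castAdd m) a

/-- The restriction of a monomial order on `K[X][U]` to the monomials of `K[X]`. -/
noncomputable def restrictOrder (n m : ℕ) (mo : MonoOrder (n + m)) : MonoOrder n where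
  lt a b := mo.lt (extExp n m a) (extExp n m b)
  total a b := by
    rcases mo.total (extExp n m a) (extExp n m b) with h | h | h
    · exact Or.inl (Finsupp.mapDomain_injective (castAdd_inj n m) h)
    · exact Or.inr (Or.inl h)
    · exact Or.inr (Or.inr h)
  trans a b c hab hbc := mo.trans _ _ _ hab hbc
  irrefl a := mo.irrefl _
  add_right a b c h := by
    show mo.lt (extExp n m (a + c)) (extExp n m (b + c))
    rw [show extExp n m (a + c) = extExp n m a + extExp n m c from Finsupp.mapDomain_add,
        show extExp n m (b + c) = extExp n m b + extExp n m c from Finsupp.mapDomain_add]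
    exact mo.add_right _ _ _ h
  zero_lt a ha := by
    show mo.lt (extExp n m 0) (extExp n m a)
    have h0 : extExp n m (0 : Fin n →₀ ℕ) = 0 := Finsupp.mapDomain_zero
    rw [h0]
    refine mo.zero_lt _ (fun h => ha ?_)
    exact Finsupp.mapDomain_injective (castAdd_inj n m) (h.trans h0.symm)

/-- The projection `K[X][U] → K[X]` sending each `u`-variable to `0`;
on polynomials of `K[X]` it inverts the canonical inclusion `K[X] → K[X][U]`. -/
noncomputable def projX (n m : ℕ) (K : Type*) [Field K] :
    MvPolynomial (Fin (n + m)) K →ₐ[K] MvPolynomial (Fin n) K :=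
  aeval (fun i : Fin (n + m) => if h : (i : ℕ) < n then X ⟨(i : ℕ), h⟩ else 0)

/-- The elimination ideal `I ∩ K[X]`, viewed as an ideal of `K[x_1,…,x_n]` via the
canonical inclusion `K[X] → K[X][U]`. -/
noncomputable def elimIdeal (n m : ℕ) {K : Type*} [Field K]
    (I : Ideal (MvPolynomial (Fin (n + m)) K)) : Ideal (MvPolynomial (Fin n) K) :=
  Ideal.comap
    (rename (Fin.castAdd m) : MvPolynomial (Fin n) K →ₐ[K] MvPolynomial (Fin (n + m)) K) I

/-- Priority of the variables for the lex order `u_1 ≻ … ≻ u_m ≻ x_1 ≻ … ≻ x_n`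
(smaller priority value = more significant variable). -/
def uPrio (n m : ℕ) (i : Fin (n + m)) : ℕ :=
  if (i : ℕ) < n then m + (i : ℕ) else (i : ℕ) - n

/-- The pure lexicographic order with `u_1 ≻ … ≻ u_m ≻ x_1 ≻ … ≻ x_n`:
`a <_lex b` iff at the most significant position where they differ, `a` is smaller. -/
def uLexLt (n m : ℕ) (a b : Fin (n + m) →₀ ℕ) : Prop :=
  ∃ i : Fin (n + m), a i < b i ∧ ∀ j : Fin (n + m), uPrio n m j < uPrio n m i → a j = b j

section WeightOrder

/-- `wdeg` is additive in the exponent. -/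
lemma wdeg_add (ω : Fin N → ℝ) (a b : Fin N →₀ ℕ) :
    wdeg ω ⇑(a + b) = wdeg ω ⇑a + wdeg ω ⇑b := by
  simp [wdeg, mul_add, Finset.sum_add_distrib]

lemma wdeg_smul (ε : ℝ) (ω : Fin N → ℝ) (d : Fin N → ℕ) :
    wdeg (ε • ω) d = ε * wdeg ω d := by
  simp [wdeg, Finset.mul_sum, mul_assoc]

/-- The monomial order given by a positive weight vector that separates exponents. -/
noncomputable def weightOrder (ω : Fin N → ℝ) (hpos : ∀ i, 0 < ω i)
    (hinj : ∀ a b : Fin N →₀ ℕ, wdeg ω ⇑a = wdeg ω ⇑b → a = b) : MonoOrder N where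
  lt a b := wdeg ω ⇑a < wdeg ω ⇑b
  total a b := by
    rcases lt_trichotomy (wdeg ω ⇑a) (wdeg ω ⇑b) with h | h | h
    · exact Or.inr (Or.inl h)
    · exact Or.inl (hinj a b h)
    · exact Or.inr (Or.inr h)
  trans _ _ _ := lt_trans
  irrefl _ := lt_irrefl _
  add_right a b c h := by
    simpa only [wdeg_add, add_lt_add_iff_right] using h
  zero_lt a ha := by
    have h0 : wdeg ω ⇑(0 : Fin N →₀ ℕ) = 0 := by simp [wdeg]
    have h1 : 0 ≤ wdeg ω ⇑a :=
      Finset.sum_nonneg fun i _ => mul_nonneg (hpos i).le (Nat.cast_nonneg _)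
    rw [h0]
    refine lt_of_le_of_ne h1 fun h => ha (hinj a 0 ?_)
    rw [h0, h]

lemma leadExp_eq (mo : MonoOrder N) {p : MvPolynomial (Fin N) K} {d : Fin N →₀ ℕ}
    (hd : d ∈ p.support) (hmax : ∀ e ∈ p.support, e ≠ d → mo.lt e d) :
    leadExp mo p = d := by
  have h : ∃ d ∈ p.support, ∀ e ∈ p.support, e ≠ d → mo.lt e d := ⟨d, hd, hmax⟩
  have hl : leadExp mo p = h.choose := dif_pos h
  rw [hl]
  obtain ⟨hs, hm⟩ := h.choose_spec
  by_contra hne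
  exact mo.irrefl _ (mo.trans _ _ _ (hmax _ hs hne) (hm _ hd (Ne.symm hne)))

lemma initForm_eq_monomial (ω : Fin N → ℝ) {p : MvPolynomial (Fin N) K} {d : Fin N →₀ ℕ}
    (hd : d ∈ p.support) (hmax : ∀ e ∈ p.support, e ≠ d → wdeg ω ⇑e < wdeg ω ⇑d) :
    initForm ω p = monomial d (p.coeff d) := by
  classical
  unfold initForm
  rw [Finset.sum_eq_single d]
  · intro e he hne
    rw [Finset.mem_filter] at he
    exact absurd (he.2 d hd) (not_le.2 (hmax e he.1 hne))
  · intro h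
    refine absurd (Finset.mem_filter.2 ⟨hd, fun e he => ?_⟩) h
    rcases eq_or_ne e d with rfl | hne
    · exact le_rfl
    · exact (hmax e he hne).le

variable {ω : Fin N → ℝ} (hpos : ∀ i, 0 < ω i)
  (hinj : ∀ a b : Fin N →₀ ℕ, wdeg ω ⇑a = wdeg ω ⇑b → a = b)

lemma leadExp_weightOrder_spec {p : MvPolynomial (Fin N) K} (hp : p ≠ 0) :
    leadExp (weightOrder ω hpos hinj) p ∈ p.support ∧
      ∀ e ∈ p.support, e ≠ leadExp (weightOrder ω hpos hinj) p →
        wdeg ω ⇑e < wdeg ω ⇑(leadExp (weightOrder ω hpos hinj) p) := by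
  obtain ⟨d, hd, hmax⟩ := p.support.exists_max_image (fun d => wdeg ω ⇑d)
    (Finset.nonempty_iff_ne_empty.2 (mt support_eq_empty.1 hp))
  have hlt : ∀ e ∈ p.support, e ≠ d → wdeg ω ⇑e < wdeg ω ⇑d := fun e he hne =>
    lt_of_le_of_ne (hmax e he) fun h => hne (hinj e d h)
  rw [leadExp_eq (weightOrder ω hpos hinj) hd hlt]
  exact ⟨hd, hlt⟩

/-- For a separating weight vector, initial forms are leading terms; this only depends on the
ray spanned by the weight vector. -/
lemma initForm_smul_eq_leadTerm {ε : ℝ} (hε : 0 < ε) (p : MvPolynomial (Fin N) K) :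
    initForm (ε • ω) p = leadTerm (weightOrder ω hpos hinj) p := by
  classical
  rcases eq_or_ne p 0 with rfl | hp
  · simp [initForm, leadTerm]
  · obtain ⟨hd, hmax⟩ := leadExp_weightOrder_spec hpos hinj hp
    refine initForm_eq_monomial _ hd fun e he hne => ?_
    simpa only [wdeg_smul, mul_lt_mul_iff_right₀ hε] using hmax e he hne

lemma initForm_monomial_add (ω : Fin N → ℝ) {d a b : Fin N →₀ ℕ} (r s : K)
    (ha : wdeg ω ⇑a < wdeg ω ⇑d) (hb : wdeg ω ⇑b < wdeg ω ⇑d) :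
    initForm ω (monomial d 1 + monomial a r + monomial b s) = monomial d (1 : K) := by
  classical
  have had : a ≠ d := by rintro rfl; exact lt_irrefl _ ha
  have hbd : b ≠ d := by rintro rfl; exact lt_irrefl _ hb
  have hc : (monomial d 1 + monomial a r + monomial b s : MvPolynomial (Fin N) K).coeff d = 1 := by
    simp [coeff_monomial, had, hbd]
  rw [initForm_eq_monomial ω (d := d), hc]
  · simp [mem_support_iff, hc]
  · intro e he hne
    by_contra hlt
    have hae : a ≠ e := by rintro rfl; exact hlt ha
    have hbe : b ≠ e := by rintro rfl; exact hlt hb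
    simp [coeff_monomial, hne.symm, hae, hbe] at he

end WeightOrder

section Example

/-- The exponent of `x ^ a * u ^ b`. -/
noncomputable def expXU (a b : ℕ) : Fin (1 + 1) →₀ ℕ :=
  Finsupp.single 0 a + Finsupp.single 1 b

@[simp] lemma expXU_zero (a b : ℕ) : expXU a b 0 = a := by simp [expXU]

@[simp] lemma expXU_one (a b : ℕ) : expXU a b 1 = b := by simp [expXU]

lemma expXU_ext {d e : Fin (1 + 1) →₀ ℕ} (h0 : d 0 = e 0) (h1 : d 1 = e 1) : d = e := by
  ext i
  fin_cases i
  · exact h0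
  · exact h1

lemma expXU_le_iff {d e : Fin (1 + 1) →₀ ℕ} : d ≤ e ↔ d 0 ≤ e 0 ∧ d 1 ≤ e 1 := by
  rw [Finsupp.le_def]
  refine ⟨fun h => ⟨h 0, h 1⟩, fun h i => ?_⟩
  fin_cases i
  · exact h.1
  · exact h.2

lemma wdeg_two (ω : Fin (1 + 1) → ℝ) (d : Fin (1 + 1) → ℕ) :
    wdeg ω d = ω 0 * d 0 + ω 1 * d 1 := by
  unfold wdeg
  exact Fin.sum_univ_two (fun i : Fin 2 => ω i * (d i : ℝ))

lemma monomial_expXU (a b : ℕ) (c : ℚ) :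
    (monomial (expXU a b) c : MvPolynomial (Fin (1 + 1)) ℚ) = C c * X 0 ^ a * X 1 ^ b := by
  rw [X_pow_eq_monomial, X_pow_eq_monomial, C_mul_monomial, monomial_mul]
  simp [expXU]

/-- The ideal `⟨x² - 1, xu² - x - u⟩` of `ℚ[x,u]`. -/
noncomputable def exIdeal : Ideal (MvPolynomial (Fin (1 + 1)) ℚ) :=
  Ideal.span {(X 0 : MvPolynomial (Fin (1 + 1)) ℚ) ^ 2 - 1, X 0 * X 1 ^ 2 - X 0 - X 1}

lemma mem_exIdeal_of_eq {p : MvPolynomial (Fin (1 + 1)) ℚ} (a b : MvPolynomial (Fin (1 + 1)) ℚ)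
    (h : a * (X 0 ^ 2 - 1) + b * (X 0 * X 1 ^ 2 - X 0 - X 1) = p) : p ∈ exIdeal :=
  Ideal.mem_span_pair.2 ⟨a, b, h⟩

lemma x_sq_mem : (monomial (expXU 2 0) 1 + monomial (expXU 0 0) (-1) + monomial (expXU 0 0) 0 :
    MvPolynomial (Fin (1 + 1)) ℚ) ∈ exIdeal := by
  refine mem_exIdeal_of_eq 1 0 ?_
  simp only [monomial_expXU, map_neg, map_one, map_zero]
  ring

lemma u_sq_mem : (monomial (expXU 0 2) 1 + monomial (expXU 1 1) (-1) + monomial (expXU 0 0) (-1) :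
    MvPolynomial (Fin (1 + 1)) ℚ) ∈ exIdeal := by
  refine mem_exIdeal_of_eq (1 - X 1 ^ 2) (X 0) ?_
  simp only [monomial_expXU, map_neg, map_one]
  ring

lemma x_mul_u_mem :
    (monomial (expXU 1 1) 1 + monomial (expXU 0 2) (-1) + monomial (expXU 0 0) 1 :
      MvPolynomial (Fin (1 + 1)) ℚ) ∈ exIdeal := by
  refine mem_exIdeal_of_eq (X 1 ^ 2 - 1) (-X 0) ?_
  simp only [monomial_expXU, map_neg, map_one]
  ring

lemma u_cube_mem :
    (monomial (expXU 0 3) 1 + monomial (expXU 1 0) (-1) + monomial (expXU 0 1) (-2) :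
      MvPolynomial (Fin (1 + 1)) ℚ) ∈ exIdeal := by
  refine mem_exIdeal_of_eq (X 1 - X 1 ^ 3) (1 + X 0 * X 1) ?_
  simp only [monomial_expXU, map_neg, map_one, map_ofNat]
  ring

lemma x_mem : (monomial (expXU 1 0) 1 + monomial (expXU 0 3) (-1) + monomial (expXU 0 1) 2 :
    MvPolynomial (Fin (1 + 1)) ℚ) ∈ exIdeal := by
  convert neg_mem u_cube_mem using 1
  simp only [neg_add, ← map_neg, neg_neg]
  ring

/-- The exponents of the standard monomials `1, u, u², x`. -/
def IsStd (d : Fin (1 + 1) →₀ ℕ) : Prop := 2 * d 0 + d 1 ≤ 2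

lemma eq_sum_of_isStd {f : MvPolynomial (Fin (1 + 1)) ℚ} (hf : ∀ d ∈ f.support, IsStd d) :
    f = monomial (expXU 0 0) (f.coeff (expXU 0 0)) + monomial (expXU 0 1) (f.coeff (expXU 0 1)) +
      monomial (expXU 0 2) (f.coeff (expXU 0 2)) + monomial (expXU 1 0) (f.coeff (expXU 1 0)) := by
  classical
  have hne : ∀ {a b a' b' : ℕ}, expXU a b = expXU a' b' ↔ a = a' ∧ b = b' := by
    intro a b a' b'
    refine ⟨fun h => ⟨?_, ?_⟩, fun h => by rw [h.1, h.2]⟩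
    · simpa using DFunLike.congr_fun h 0
    · simpa using DFunLike.congr_fun h 1
  ext d
  by_cases hd : IsStd d
  · have key : d = expXU 0 0 ∨ d = expXU 0 1 ∨ d = expXU 0 2 ∨ d = expXU 1 0 := by
      have hd' : d = expXU (d 0) (d 1) := expXU_ext (by simp) (by simp)
      rw [hd']
      simp only [hne]
      unfold IsStd at hd
      omega
    rcases key with rfl | rfl | rfl | rfl <;> simp [coeff_monomial, hne]
  · have h0 : f.coeff d = 0 := by
      by_contra h
      exact hd (hf d (mem_support_iff.2 h))
    have hn : ∀ a b, 2 * a + b ≤ 2 → expXU a b ≠ d := by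
      rintro a b h rfl
      exact hd (by simpa [IsStd] using h)
    simp [h0, coeff_monomial, hn]

/-- The homomorphism `x ↦ t³ - 2t`, `u ↦ t`, which identifies `ℚ[x,u]/I` with
`ℚ[t]/(t⁴ - 3t² + 1)`. -/
noncomputable def exHom : MvPolynomial (Fin (1 + 1)) ℚ →ₐ[ℚ] Polynomial ℚ :=
  aeval ![Polynomial.X ^ 3 - 2 * Polynomial.X, Polynomial.X]

lemma dvd_exHom {f : MvPolynomial (Fin (1 + 1)) ℚ} (hf : f ∈ exIdeal) :
    (Polynomial.X ^ 4 - 3 * Polynomial.X ^ 2 + 1 : Polynomial ℚ) ∣ exHom f := by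
  obtain ⟨a, b, rfl⟩ := Ideal.mem_span_pair.1 hf
  have h0 : exHom (X 0) = Polynomial.X ^ 3 - 2 * Polynomial.X := by simp [exHom]
  have h1 : exHom (X 1) = Polynomial.X := by simp [exHom]
  refine ⟨exHom a * (Polynomial.X ^ 2 - 1) + exHom b * Polynomial.X, ?_⟩
  simp only [map_add, map_mul, map_sub, map_pow, map_one, h0, h1]
  ring

lemma eq_zero_of_isStd {f : MvPolynomial (Fin (1 + 1)) ℚ} (hf : f ∈ exIdeal)
    (hs : ∀ d ∈ f.support, IsStd d) : f = 0 := by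
  have hsum := eq_sum_of_isStd hs
  generalize f.coeff (expXU 0 0) = a at hsum
  generalize f.coeff (expXU 0 1) = b at hsum
  generalize f.coeff (expXU 0 2) = c at hsum
  generalize f.coeff (expXU 1 0) = e at hsum
  have himg : exHom f = Polynomial.C e * Polynomial.X ^ 3 + Polynomial.C c * Polynomial.X ^ 2 +
      Polynomial.C (b - 2 * e) * Polynomial.X + Polynomial.C a := by
    have h0 : exHom (X 0) = Polynomial.X ^ 3 - 2 * Polynomial.X := by simp [exHom]
    have h1 : exHom (X 1) = Polynomial.X := by simp [exHom]
    have hC : ∀ r : ℚ, exHom (C r) = Polynomial.C r := fun r => by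
      simp [exHom, Polynomial.algebraMap_eq]
    rw [hsum]
    simp only [monomial_expXU, map_add, map_mul, map_sub, map_pow, h0, h1, hC, map_ofNat]
    ring
  have hdeg : (exHom f).degree <
      (Polynomial.X ^ 4 - 3 * Polynomial.X ^ 2 + 1 : Polynomial ℚ).degree := by
    have hq : (Polynomial.X ^ 4 - 3 * Polynomial.X ^ 2 + 1 : Polynomial ℚ).degree = 4 := by
      compute_degree!
    rw [hq, himg]
    exact lt_of_le_of_lt Polynomial.degree_cubic_le (by norm_num)
  have hz := Polynomial.eq_zero_of_dvd_of_degree_lt (dvd_exHom hf) hdeg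
  rw [himg] at hz
  have k (n : ℕ) := congrArg (fun p : Polynomial ℚ => p.coeff n) hz
  have k0 := k 0
  have k1 := k 1
  have k2 := k 2
  have k3 := k 3
  simp [Polynomial.coeff_X, Polynomial.coeff_C, Polynomial.coeff_X_pow] at k0 k1 k2 k3
  subst k0 k2 k3
  have hb : b = 0 := by linarith
  subst hb
  rw [hsum]
  simp

/-- A weight vector in the interior of the Gröbner cone. -/
noncomputable def exWeight : Fin (1 + 1) → ℝ := ![√2, 1]

lemma wdeg_exWeight (d : Fin (1 + 1) → ℕ) : wdeg exWeight d = √2 * d 0 + d 1 := by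
  simp [wdeg_two, exWeight]

lemma exWeight_pos (i : Fin (1 + 1)) : 0 < exWeight i := by
  fin_cases i <;> simp [exWeight]

lemma exWeight_inj (a b : Fin (1 + 1) →₀ ℕ) (h : wdeg exWeight ⇑a = wdeg exWeight ⇑b) :
    a = b := by
  rw [wdeg_exWeight, wdeg_exWeight] at h
  have h0 : a 0 = b 0 := by
    by_contra hne
    have hne' : (a 0 : ℝ) - b 0 ≠ 0 := sub_ne_zero.2 (by exact_mod_cast hne)
    refine irrational_sqrt_two ⟨((b 1 : ℚ) - a 1) / ((a 0 : ℚ) - b 0), ?_⟩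
    push_cast
    rw [div_eq_iff hne']
    linarith
  rw [h0] at h
  exact expXU_ext h0 (by exact_mod_cast add_left_cancel h)

/-- The monomial order defined by `exWeight`. -/
noncomputable def exOrder : MonoOrder (1 + 1) := weightOrder exWeight exWeight_pos exWeight_inj

lemma sqrt_two_bounds : 1.4 < √2 ∧ √2 < 1.5 :=
  ⟨Real.lt_sqrt_of_sq_lt (by norm_num), (Real.sqrt_lt' (by norm_num)).2 (by norm_num)⟩

lemma isStd_of_wdeg_le {d e : Fin (1 + 1) →₀ ℕ} (hd : IsStd d)
    (h : wdeg exWeight ⇑e ≤ wdeg exWeight ⇑d) : IsStd e := by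
  obtain ⟨h1, h2⟩ := sqrt_two_bounds
  rw [wdeg_exWeight, wdeg_exWeight] at h
  unfold IsStd at hd ⊢
  have hd' : 2 * (d 0 : ℝ) + d 1 ≤ 2 := by exact_mod_cast hd
  have hd0 : (0 : ℝ) ≤ d 0 := Nat.cast_nonneg _
  have he0 : (0 : ℝ) ≤ e 0 := Nat.cast_nonneg _
  have hle : 1.4 * (e 0 : ℝ) + e 1 ≤ 2 := by nlinarith
  have hle' : 14 * e 0 + 10 * e 1 ≤ 20 := by
    have : 14 * (e 0 : ℝ) + 10 * e 1 ≤ 20 := by linarith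
    exact_mod_cast this
  omega

lemma not_isStd_leadExp {f : MvPolynomial (Fin (1 + 1)) ℚ} (hf : f ∈ exIdeal) (h0 : f ≠ 0) :
    ¬ IsStd (leadExp exOrder f) := by
  intro hs
  obtain ⟨-, hmax⟩ := leadExp_weightOrder_spec exWeight_pos exWeight_inj h0
  refine h0 (eq_zero_of_isStd hf fun e he => ?_)
  rcases eq_or_ne e (leadExp exOrder f) with rfl | hne
  · exact hs
  · exact isStd_of_wdeg_le hs (hmax e he hne).le

lemma ltIdealO_le : ltIdealO exOrder exIdeal ≤
    Ideal.span ((fun s => monomial s (1 : ℚ)) '' {d : Fin (1 + 1) →₀ ℕ | ¬ IsStd d}) := by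
  refine Ideal.span_le.2 ?_
  rintro _ ⟨f, hf, rfl⟩
  rcases eq_or_ne f 0 with rfl | h0
  · simp [leadTerm]
  · refine mem_ideal_span_monomial_image.2 fun d hd => ⟨_, not_isStd_leadExp hf h0, ?_⟩
    exact (Finset.mem_singleton.1 (support_monomial_subset hd)).ge

lemma monomial_notMem_ltIdealO {d : Fin (1 + 1) →₀ ℕ} (hd : IsStd d) :
    monomial d (1 : ℚ) ∉ ltIdealO exOrder exIdeal := by
  intro h
  obtain ⟨e, he, hle⟩ := mem_ideal_span_monomial_image.1 (ltIdealO_le h) d (by simp)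
  rw [expXU_le_iff] at hle
  refine he ?_
  unfold IsStd at hd ⊢
  omega

lemma ltIdealW_smul_exWeight {ε : ℝ} (hε : 0 < ε) (I : Ideal (MvPolynomial (Fin (1 + 1)) ℚ)) :
    ltIdealW (ε • exWeight) I = ltIdealO exOrder I := by
  unfold ltIdealW ltIdealO
  congr 1
  exact Set.image_congr' fun p => initForm_smul_eq_leadTerm exWeight_pos exWeight_inj hε p

lemma monomial_mem_ltIdealO {d a b : Fin (1 + 1) →₀ ℕ} {r s : ℚ}
    (hmem : monomial d 1 + monomial a r + monomial b s ∈ exIdeal)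
    (ha : wdeg exWeight ⇑a < wdeg exWeight ⇑d) (hb : wdeg exWeight ⇑b < wdeg exWeight ⇑d) :
    monomial d (1 : ℚ) ∈ ltIdealO exOrder exIdeal := by
  rw [← ltIdealW_smul_exWeight one_pos, one_smul]
  exact Ideal.subset_span ⟨_, hmem, initForm_monomial_add exWeight r s ha hb⟩

lemma IsRedGB.exists_leadExp_le {G : Set (MvPolynomial (Fin (1 + 1)) ℚ)}
    (hG : IsRedGB exOrder exIdeal G) {d : Fin (1 + 1) →₀ ℕ}
    (hd : monomial d (1 : ℚ) ∈ ltIdealO exOrder exIdeal) :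
    ∃ g ∈ G, leadExp exOrder g ≤ d ∧ ¬ IsStd (leadExp exOrder g) := by
  obtain ⟨-, hGI, hspan, hnorm, -⟩ := hG
  have himg : leadTerm exOrder '' G =
      (fun s => monomial s (1 : ℚ)) '' (leadExp exOrder '' G) := by
    rw [Set.image_image]
    exact Set.image_congr fun g hg => by rw [leadTerm, (hnorm g hg).2]
  rw [← hspan, himg] at hd
  obtain ⟨_, ⟨g, hg, rfl⟩, hle⟩ := mem_ideal_span_monomial_image.1 hd d (by simp)
  exact ⟨g, hg, hle, not_isStd_leadExp (hGI hg) (hnorm g hg).1⟩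

lemma isEO_exOrder : IsEO 1 exOrder exIdeal := by
  intro G hG g hg hlead
  obtain ⟨s1, s2⟩ := sqrt_two_bounds
  obtain ⟨-, hGI, -, hnorm, hred⟩ := id hG
  obtain ⟨hg0, hg1⟩ := hnorm g hg
  obtain ⟨-, hmax⟩ := leadExp_weightOrder_spec exWeight_pos exWeight_inj hg0
  change ∀ e ∈ g.support, e ≠ leadExp exOrder g →
    wdeg exWeight ⇑e < wdeg exWeight ⇑(leadExp exOrder g) at hmax
  have hstd := not_isStd_leadExp (hGI hg) hg0
  have hL1 : leadExp exOrder g 1 = 0 := by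
    refine hlead _ ?_ 1 (by simp)
    rw [leadTerm, hg1]
    simp
  obtain ⟨h, hh, hle, hns⟩ := hG.exists_leadExp_le (monomial_mem_ltIdealO x_sq_mem
    (by simp [wdeg_exWeight]) (by simp [wdeg_exWeight]))
  obtain ⟨p, hp, hple, hpns⟩ := hG.exists_leadExp_le (monomial_mem_ltIdealO x_mul_u_mem
    (by simp [wdeg_exWeight]; linarith) (by simp [wdeg_exWeight]; linarith))
  obtain ⟨q, hq, hqle, hqns⟩ := hG.exists_leadExp_le (monomial_mem_ltIdealO u_cube_mem
    (by simp [wdeg_exWeight]; linarith) (by simp [wdeg_exWeight]))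
  rw [expXU_le_iff, expXU_zero, expXU_one] at hle hple hqle
  unfold IsStd at hstd hns hpns hqns
  have hgs : leadExp exOrder g ∈ g.support := by rw [mem_support_iff, hg1]; exact one_ne_zero
  have hL0 : leadExp exOrder g 0 = 2 := by
    by_contra hne
    have hhg : h ≠ g := by
      rintro rfl
      omega
    refine hred h hh g hg hhg _ hgs (expXU_le_iff.2 ?_)
    omega
  have hL : leadExp exOrder g = expXU 2 0 := expXU_ext (by simp [hL0]) (by simp [hL1])
  have hsupp : ∀ d ∈ g.support, d ≠ expXU 2 0 → IsStd d := by
    intro d hd hne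
    have hw := hmax d hd (by rwa [hL])
    have hpg : p ≠ g := by
      rintro rfl
      omega
    have hqg : q ≠ g := by
      rintro rfl
      omega
    have hpd := hred p hp g hg hpg d hd
    have hqd := hred q hq g hg hqg d hd
    rw [expXU_le_iff] at hpd hqd
    rw [hL, wdeg_exWeight, wdeg_exWeight] at hw
    simp only [expXU_zero, expXU_one] at hw
    have hd0 : d 0 < 3 := by
      by_contra hge
      have : (3 : ℝ) ≤ d 0 := by exact_mod_cast not_lt.1 hge
      have : (0 : ℝ) ≤ d 1 := Nat.cast_nonneg _
      push_cast at hw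
      nlinarith
    have hne' : ¬ (d 0 = 2 ∧ d 1 = 0) := fun h' =>
      hne (expXU_ext (by simp [h'.1]) (by simp [h'.2]))
    unfold IsStd
    omega
  have hzero : g - (monomial (expXU 2 0) 1 + monomial (expXU 0 0) (-1) +
      monomial (expXU 0 0) 0) = 0 := by
    classical
    refine eq_zero_of_isStd (sub_mem (hGI hg) x_sq_mem) fun d hd => ?_
    rw [mem_support_iff] at hd
    by_contra hns'
    have h00 : expXU 0 0 ≠ d := by
      rintro rfl
      exact hns' (by simp [IsStd])
    refine hd ?_
    rcases eq_or_ne d (expXU 2 0) with rfl | hne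
    · rw [hL] at hg1
      simp [coeff_monomial, h00, hg1]
    · have hgd : g.coeff d = 0 := by
        by_contra hc
        exact hns' (hsupp d (mem_support_iff.2 hc) hne)
      simp [coeff_monomial, h00, hne.symm, hgd]
  intro d hd i hi
  classical
  rw [sub_eq_zero.1 hzero, mem_support_iff] at hd
  have hi1 : i = 1 := by
    fin_cases i
    · simp at hi
    · rfl
  subst hi1
  by_contra hd1
  have h20 : expXU 2 0 ≠ d := by
    rintro rfl
    simp at hd1
  have h00 : expXU 0 0 ≠ d := by
    rintro rfl
    simp at hd1
  simp [coeff_monomial, h20, h00] at hd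

lemma gCone_exOrder_le {ω : Fin (1 + 1) → ℝ} (hω : ω ∈ gCone exOrder exIdeal) :
    ω 1 ≤ ω 0 ∧ ω 0 ≤ 3 * ω 1 := by
  have hclosed : IsClosed {ω : Fin (1 + 1) → ℝ | ω 1 ≤ ω 0 ∧ ω 0 ≤ 3 * ω 1} :=
    (isClosed_le (continuous_apply 1) (continuous_apply 0)).and
      (isClosed_le (continuous_apply 0) (continuous_const.mul (continuous_apply 1)))
  refine closure_minimal ?_ hclosed hω
  rintro ω ⟨hpos, heq⟩
  have h0 := hpos 0
  have h1 := hpos 1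
  constructor
  · by_contra! hlt
    refine monomial_notMem_ltIdealO (d := expXU 0 2) (by simp [IsStd]) ?_
    rw [← heq]
    refine Ideal.subset_span ⟨_, u_sq_mem, initForm_monomial_add ω _ _ ?_ ?_⟩ <;>
      simp [wdeg_two] <;> linarith
  · by_contra! hlt
    refine monomial_notMem_ltIdealO (d := expXU 1 0) (by simp [IsStd]) ?_
    rw [← heq]
    refine Ideal.subset_span ⟨_, x_mem, initForm_monomial_add ω _ _ ?_ ?_⟩ <;>
      simp [wdeg_two] <;> linarith

lemma zero_mem_gCone_exOrder : 0 ∈ gCone exOrder exIdeal := by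
  have hlim : Filter.Tendsto (fun ε : ℝ => ε • exWeight) (nhdsWithin 0 (Set.Ioi 0)) (nhds 0) := by
    have hc : Continuous fun ε : ℝ => ε • exWeight := by fun_prop
    have := hc.tendsto 0
    rw [zero_smul] at this
    exact this.mono_left nhdsWithin_le_nhds
  refine mem_closure_of_tendsto hlim ?_
  filter_upwards [self_mem_nhdsWithin] with ε hε
  exact ⟨fun i => mul_nonneg (le_of_lt hε) (exWeight_pos i).le, ltIdealW_smul_exWeight hε _⟩

end Example

/-- There is an ideal with an `I`-specific elimination order whose Gröbner
cone meets the boundary of the orthant only in the origin: for `n = m = 1` and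
`I = ⟨x² - 1, xu² - x - u⟩ ⊆ ℚ[x,u]`, some `I`-EO `≺` for `u` has
`C_≺(I) ∩ ∂(ℝ²_{≥0}) = {0}`. -/
theorem exists_EO_cone_interior :
    ∃ mo : MonoOrder (1 + 1),
      IsEO 1 mo (Ideal.span {(X 0 : MvPolynomial (Fin (1 + 1)) ℚ) ^ 2 - 1,
          X 0 * X 1 ^ 2 - X 0 - X 1}) ∧
      gCone mo (Ideal.span {(X 0 : MvPolynomial (Fin (1 + 1)) ℚ) ^ 2 - 1,
          X 0 * X 1 ^ 2 - X 0 - X 1}) ∩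
        {ω : Fin (1 + 1) → ℝ | (∀ i, 0 ≤ ω i) ∧ ∃ i, ω i = 0} = {0} := by
  refine ⟨exOrder, isEO_exOrder, ?_⟩
  ext ω
  simp only [Set.mem_inter_iff, Set.mem_ofPred_eq, Set.mem_singleton_iff]
  constructor
  · rintro ⟨hω, hpos, i, hi⟩
    obtain ⟨h1, h2⟩ := gCone_exOrder_le hω
    have h0 := hpos 0
    have h1' := hpos 1
    have h : ω 0 = 0 ∧ ω 1 = 0 := by
      fin_cases i <;> simp at hi <;> constructor <;> linarith
    ext j
    fin_cases j
    · exact h.1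
    · exact h.2
  · rintro rfl
    exact ⟨zero_mem_gCone_exOrder, fun _ => le_rfl, 0, rfl⟩
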